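/- For every integer n ≥ 1, T_n(T(Λ)) = T_n(Λ) ⋉ Λ*; that is, an element (a,φ) ∈ T(Λ) satisfies (a,φ)^{p^n} ∈ K(T(Λ)) if and only if a^{p^n} ∈ K(Λ). -/

import Mathlib

/- Common setup: Λ is a finite-dimensional k-algebra, Λ* = Hom_k(Λ,k) its dual,
  made into a Λ-Λ-bimodule by (a•φ) b = φ (b*a) and (op a • φ) b = φ (a*b).
  The trivial extension T(Λ) = Λ ⋉ Λ* is realized as `TrivSqZeroExt Λ (Module.Dual k Λ)`,
  whose multiplication is (a,φ)·(b,ψ) = (ab, a•ψ + φ•b). -/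

open TrivSqZeroExt MulOpposite

section Setup

variable (k Λ : Type*) [Field k] [Ring Λ] [Algebra k Λ]

/-- Left action of `Λ` on its `k`-linear dual: `(a • φ) b = φ (b * a)`. -/
noncomputable instance dualLeftSMul : SMul Λ (Module.Dual k Λ) :=
  ⟨fun a φ => φ ∘ₗ LinearMap.mulRight k a⟩

/-- Right action of `Λ` on its `k`-linear dual: `(op a • φ) b = φ (a * b)`. -/
noncomputable instance dualRightSMul : SMul Λᵐᵒᵖ (Module.Dual k Λ) :=
  ⟨fun a φ => φ ∘ₗ LinearMap.mulLeft k a.unop⟩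

variable {k Λ}

@[simp] lemma dual_lsmul_apply (a : Λ) (φ : Module.Dual k Λ) (b : Λ) :
    (a • φ) b = φ (b * a) := rfl

@[simp] lemma dual_rsmul_apply (a : Λᵐᵒᵖ) (φ : Module.Dual k Λ) (b : Λ) :
    (a • φ) b = φ (a.unop * b) := rfl

variable (k Λ)

noncomputable instance dualLeftModule : Module Λ (Module.Dual k Λ) where
  one_smul φ := by ext b; simp
  mul_smul a b φ := by ext c; simp [mul_assoc]
  smul_zero a := by ext; simp
  smul_add a φ ψ := by ext; simp
  add_smul a b φ := by ext c; simp [mul_add]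
  zero_smul φ := by ext; simp

noncomputable instance dualRightModule : Module Λᵐᵒᵖ (Module.Dual k Λ) where
  one_smul φ := by ext b; simp
  mul_smul a b φ := by ext c; simp [mul_assoc]
  smul_zero a := by ext; simp
  smul_add a φ ψ := by ext; simp
  add_smul a b φ := by ext c; simp [add_mul]
  zero_smul φ := by ext; simp

noncomputable instance dualSMulCommClass : SMulCommClass Λ Λᵐᵒᵖ (Module.Dual k Λ) where
  smul_comm a b φ := by ext c; simp [mul_assoc]

/-- The commutator space `K(A)` of an algebra `A`:
the `k`-subspace spanned by all commutators `a*b - b*a`. -/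
def commSpace (A : Type*) [Ring A] [Module k A] : Submodule k A :=
  Submodule.span k {x : A | ∃ a b : A, x = a * b - b * a}

/-- `[Λ,Λ*]`: the `k`-subspace of `Λ*` spanned by all `a•φ - φ•a`. -/
noncomputable def dualCommSpace : Submodule k (Module.Dual k Λ) :=
  Submodule.span k
    {ψ : Module.Dual k Λ | ∃ (a : Λ) (φ : Module.Dual k Λ), ψ = a • φ - op a • φ}

/-- The trivial extension `T(Λ) = Λ ⋉ Λ*`. -/
abbrev TrivExt := TrivSqZeroExt Λ (Module.Dual k Λ)

/-- The symmetrizing bilinear form on `T(Λ)`: `⟨(a,φ),(b,ψ)⟩ = ψ a + φ b`. -/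
noncomputable def trivExtForm (x y : TrivExt k Λ) : k := y.snd x.fst + x.snd y.fst

end Setup

section CommSpace

variable {k Λ : Type*} [Field k] [Ring Λ] [Algebra k Λ]

lemma mul_sub_mul_mem_commSpace {A : Type*} [Ring A] [Module k A] (a b : A) :
    a * b - b * a ∈ commSpace k A :=
  Submodule.subset_span ⟨a, b, rfl⟩

lemma fst_mem_commSpace {x : TrivExt k Λ} (hx : x ∈ commSpace k (TrivExt k Λ)) :
    x.fst ∈ commSpace k Λ := by
  induction hx using Submodule.span_induction with
  | mem x h =>
    obtain ⟨a, b, rfl⟩ := h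
    simpa using mul_sub_mul_mem_commSpace a.fst b.fst
  | zero => simp
  | add x y _ _ hx hy => simpa using add_mem hx hy
  | smul c x _ hx => simpa using Submodule.smul_mem _ c hx

lemma inl_mem_commSpace {a : Λ} (ha : a ∈ commSpace k Λ) :
    (inl a : TrivExt k Λ) ∈ commSpace k (TrivExt k Λ) := by
  induction ha using Submodule.span_induction with
  | mem x h =>
    obtain ⟨a, b, rfl⟩ := h
    simpa only [inl_sub, inl_mul] using
      mul_sub_mul_mem_commSpace (k := k) (inl a : TrivExt k Λ) (inl b)
  | zero => simp
  | add x y _ _ hx hy => simpa only [inl_add] using add_mem hx hy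
  | smul c x _ hx => simpa only [inl_smul] using Submodule.smul_mem _ c hx

lemma inr_mem_commSpace {φ : Module.Dual k Λ} (hφ : φ ∈ dualCommSpace k Λ) :
    (inr φ : TrivExt k Λ) ∈ commSpace k (TrivExt k Λ) := by
  induction hφ using Submodule.span_induction with
  | mem x h =>
    obtain ⟨a, φ, rfl⟩ := h
    simpa only [inr_sub, inl_mul_inr, inr_mul_inl] using
      mul_sub_mul_mem_commSpace (k := k) (inl a : TrivExt k Λ) (inr φ)
  | zero => simp
  | add x y _ _ hx hy => simpa only [inr_add] using add_mem hx hy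
  | smul c x _ hx => simpa only [inr_smul] using Submodule.smul_mem _ c hx

lemma pow_smul_sub_op_pow_smul_mem_dualCommSpace (a : Λ) (i j : ℕ) (φ : Module.Dual k Λ) :
    a ^ (i + j) • φ - op (a ^ i) • a ^ j • φ ∈ dualCommSpace k Λ :=
  Submodule.subset_span ⟨a ^ i, a ^ j • φ, by rw [pow_add, mul_smul]⟩

/-- If `m = 0` in `k`, the `m`-th power of an element of `T(Λ)` has its `Λ*`-part in `[Λ,Λ*]`. -/
lemma snd_pow_mem_dualCommSpace (x : TrivExt k Λ) {m : ℕ} (hm : (m : k) = 0) :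
    (x ^ m).snd ∈ dualCommSpace k Λ := by
  have hsum : (x ^ m).snd = ∑ i ∈ Finset.range m,
      op (x.fst ^ i) • x.fst ^ (m - 1 - i) • x.snd := by
    rw [snd_pow_eq_sum, Finset.sum, Finset.range_val, Multiset.range, Multiset.map_coe,
      Multiset.sum_coe]
    rfl
  have hzero : ∑ _i ∈ Finset.range m, x.fst ^ (m - 1) • x.snd = 0 := by
    rw [Finset.sum_const, Finset.card_range, ← Nat.cast_smul_eq_nsmul k, hm, zero_smul]
  rw [hsum, ← neg_mem_iff, ← zero_sub, ← hzero, ← Finset.sum_sub_distrib]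
  refine sum_mem fun i hi => ?_
  have := pow_smul_sub_op_pow_smul_mem_dualCommSpace x.fst i (m - 1 - i) x.snd
  rwa [Nat.add_sub_cancel' (by have := Finset.mem_range.mp hi; omega)] at this

end CommSpace

/-- for `n ≥ 1`, `T_n(T(Λ)) = T_n(Λ) ⋉ Λ*`: an element `(a,φ)` of the
trivial extension satisfies `(a,φ)^(p^n) ∈ K(T(Λ))` iff `a^(p^n) ∈ K(Λ)`. -/
theorem stmt_5 (k Λ : Type*) [Field k] (p : ℕ) [Fact p.Prime] [CharP k p]
    [Ring Λ] [Algebra k Λ] [FiniteDimensional k Λ] (n : ℕ) (hn : 1 ≤ n)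
    (x : TrivExt k Λ) :
    x ^ p ^ n ∈ commSpace k (TrivExt k Λ) ↔ x.fst ^ p ^ n ∈ commSpace k Λ := by
  refine ⟨fun h => by simpa only [fst_pow] using fst_mem_commSpace h, fun h => ?_⟩
  rw [← inl_fst_add_inr_snd_eq (x ^ p ^ n), fst_pow]
  refine add_mem (inl_mem_commSpace h) (inr_mem_commSpace (snd_pow_mem_dualCommSpace x ?_))
  rw [Nat.cast_pow, CharP.cast_eq_zero, zero_pow (by omega)]
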